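/- arXiv:2007.10432 — 2 statements merged into one kernel-verified Lean document; each statement's English description precedes it below -/
import Mathlib

section
/- Under strict, one-to-one targeting with 𝒵₀ := 𝒵 ∖ 𝒵* nonempty, suppose τ* is a singleton with element τ and T(z) is the unique maximizer of t ↦ U_z(t) + u_t for each z. Let A := {z ∈ 𝒵* : T(z) = t̄(z)}. Then: (1) τ ∈ t̄(A) ∪ (𝒯 ∖ 𝒯*), where t̄(A) := {t̄(z) : z ∈ A}; (2a) T(z) = t̄(z) for all z ∈ A; (2b) T(z) = τ for all z ∈ 𝒵 ∖ A. -/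
open Set

noncomputable section

variable {𝒯 𝒵 : Type*}

/-- Relative mean value `Δ_z(t) = U_z(t) - U_z(t₀)` of treatment `t` under instrument `z`,
with reference treatment `t0`. -/
def Δrel (U : 𝒵 → 𝒯 → ℝ) (t0 : 𝒯) (z : 𝒵) (t : 𝒯) : ℝ := U z t - U z t0

/-- `Z̄(t)`: the set of instruments maximizing `z ↦ Δ_z(t)`. -/
def Zbar (U : 𝒵 → 𝒯 → ℝ) (t0 : 𝒯) (t : 𝒯) : Set 𝒵 :=
  {z | ∀ z' : 𝒵, Δrel U t0 z' t ≤ Δrel U t0 z t}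

/-- `𝒯*`: the set of targeted treatments. -/
def Tstar (U : 𝒵 → 𝒯 → ℝ) (t0 : 𝒯) : Set 𝒯 := {t | Zbar U t0 t ≠ univ}

/-- `𝒵*`: the set of targeting instruments. -/
def Zstar (U : 𝒵 → 𝒯 → ℝ) (t0 : 𝒯) : Set 𝒵 := ⋃ t ∈ Tstar U t0, Zbar U t0 t

/-- `T̄(z)`: the set of targeted treatments targeted by `z`. -/
def Tbar (U : 𝒵 → 𝒯 → ℝ) (t0 : 𝒯) (z : 𝒵) : Set 𝒯 :=
  {t | t ∈ Tstar U t0 ∧ z ∈ Zbar U t0 t}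

/-- `τ*`: the set of top alternative treatments
(the maximizers of `t ↦ Δ̲_t + u_t` over `𝒯`). -/
def TopAlt (Δlow : 𝒯 → ℝ) (u : 𝒯 → ℝ) : Set 𝒯 :=
  {t | ∀ t' : 𝒯, Δlow t' + u t' ≤ Δlow t + u t}

/-- Under strict targeting, no relative mean falls below the common low value. -/
theorem low_le_Δrel {U : 𝒵 → 𝒯 → ℝ} {t0 : 𝒯} {Δbar Δlow : 𝒯 → ℝ}
    (hΔbar : ∀ t : 𝒯, ∀ z ∈ Zbar U t0 t, Δrel U t0 z t = Δbar t)
    (hstrict : ∀ t ∈ Tstar U t0, ∀ z ∉ Zbar U t0 t, Δrel U t0 z t = Δlow t)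
    (hΔlow : ∀ t ∉ Tstar U t0, Δlow t = Δbar t) (z : 𝒵) (t : 𝒯) :
    Δlow t ≤ Δrel U t0 z t := by
  by_cases ht : t ∈ Tstar U t0
  · by_cases hz : z ∈ Zbar U t0 t
    · obtain ⟨z', hz'⟩ := (ne_univ_iff_exists_notMem _).1 ht
      exact (hstrict t ht z' hz').symm.le.trans (hz z')
    · exact (hstrict t ht z hz).ge
  · have hz : z ∈ Zbar U t0 t := (not_not.1 ht : Zbar U t0 t = univ) ▸ mem_univ z
    exact ((hΔlow t ht).trans (hΔbar t z hz).symm).le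

/-- A treatment not targeted by `z` has relative mean under `z` equal to its low value. -/
theorem Δrel_eq_low_of_notMem_Tbar {U : 𝒵 → 𝒯 → ℝ} {t0 : 𝒯} {Δbar Δlow : 𝒯 → ℝ}
    (hΔbar : ∀ t : 𝒯, ∀ z ∈ Zbar U t0 t, Δrel U t0 z t = Δbar t)
    (hstrict : ∀ t ∈ Tstar U t0, ∀ z ∉ Zbar U t0 t, Δrel U t0 z t = Δlow t)
    (hΔlow : ∀ t ∉ Tstar U t0, Δlow t = Δbar t) {z : 𝒵} {t : 𝒯} (h : t ∉ Tbar U t0 z) :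
    Δrel U t0 z t = Δlow t := by
  by_cases ht : t ∈ Tstar U t0
  · exact hstrict t ht z fun hz => h ⟨ht, hz⟩
  · have hz : z ∈ Zbar U t0 t := (not_not.1 ht : Zbar U t0 t = univ) ▸ mem_univ z
    exact (hΔbar t z hz).trans (hΔlow t ht).symm

/-- Corollary 1 (unfiltered classes under strict, one-to-one targeting):
with `τ` the unique top alternative treatment and `A := {z ∈ 𝒵* : T(z) = t̄(z)}`:
(1) `τ ∈ t̄(A) ∪ (𝒯 ∖ 𝒯*)`; (2a) `T(z) = t̄(z)` for `z ∈ A`; (2b) `T(z) = τ` for `z ∉ A`. -/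
theorem statement4 [Fintype 𝒯] [Fintype 𝒵]
    (U : 𝒵 → 𝒯 → ℝ) (u : 𝒯 → ℝ) (t0 : 𝒯) (T : 𝒵 → 𝒯)
    (hARUM : ∀ z t, t ≠ T z → U z t + u t < U z (T z) + u (T z))
    (zbar : 𝒯 → 𝒵) (tbar : 𝒵 → 𝒯)
    (h11Z : ∀ t ∈ Tstar U t0, Zbar U t0 t = {zbar t})
    (h11T : ∀ z ∈ Zstar U t0, Tbar U t0 z = {tbar z})
    (Δbar Δlow : 𝒯 → ℝ)
    (hΔbar : ∀ t : 𝒯, ∀ z ∈ Zbar U t0 t, Δrel U t0 z t = Δbar t)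
    (hstrict : ∀ t ∈ Tstar U t0, ∀ z ∉ Zbar U t0 t, Δrel U t0 z t = Δlow t)
    (hΔlow : ∀ t ∉ Tstar U t0, Δlow t = Δbar t)
    (hZ0 : (univ \ Zstar U t0).Nonempty)
    (τ : 𝒯) (hτ : TopAlt Δlow u = {τ}) :
    τ ∈ tbar '' {z | z ∈ Zstar U t0 ∧ T z = tbar z} ∪ (univ \ Tstar U t0)
    ∧ (∀ z ∈ {z | z ∈ Zstar U t0 ∧ T z = tbar z}, T z = tbar z)
    ∧ (∀ z ∉ {z | z ∈ Zstar U t0 ∧ T z = tbar z}, T z = τ) := by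
  have mem_Zstar {z : 𝒵} {t : 𝒯} (h : t ∈ Tbar U t0 z) : z ∈ Zstar U t0 :=
    mem_biUnion h.1 h.2
  have eq_tbar {z : 𝒵} {t : 𝒯} (h : t ∈ Tbar U t0 z) : t = tbar z := by
    have h' := h
    rwa [h11T z (mem_Zstar h)] at h'
  have eq_top : ∀ z ∉ {z | z ∈ Zstar U t0 ∧ T z = tbar z}, T z = τ := by
    intro z hz
    have hT : T z ∉ Tbar U t0 z := fun h => hz ⟨mem_Zstar h, eq_tbar h⟩
    have hlow := Δrel_eq_low_of_notMem_Tbar hΔbar hstrict hΔlow hT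
    have hmem : T z ∈ TopAlt Δlow u := by
      intro t
      rcases eq_or_ne t (T z) with rfl | ht
      · exact le_rfl
      · have hle := low_le_Δrel hΔbar hstrict hΔlow z t
        have hlt := hARUM z t ht
        unfold Δrel at hle hlow
        linarith
    rwa [hτ] at hmem
  refine ⟨?_, fun z hz => hz.2, eq_top⟩
  by_cases hs : τ ∈ Tstar U t0
  · have hτz : τ ∈ Tbar U t0 (zbar τ) := ⟨hs, by rw [h11Z τ hs]; rfl⟩
    refine Or.inl ⟨zbar τ, ?_, (eq_tbar hτz).symm⟩
    by_contra hA
    exact hA ⟨mem_Zstar hτz, (eq_top _ hA).trans (eq_tbar hτz)⟩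
  · exact Or.inr ⟨mem_univ _, hs⟩
end
end

section
/- In the 3×3 ARUM with strict one-to-one targeting, the following probabilities are identified: P(A_1) = P(1|2); P(A_2) = P(2|1); P(C_{112}) = P(1|0) − P(1|2); P(C_{212}) = P(2|0) − P(2|1); P(C_{010} ∪ C_{012}) = P(0|0) − P(0|1); P(C_{002} ∪ C_{012}) = P(0|0) − P(0|2); P(C_{010} ∪ A_0) = P(0|2). The model has the testable implications P(1|0) ≥ P(1|2), P(2|0) ≥ P(2|1), and P(0|0) ≥ max(P(0|1), P(0|2)). Moreover, setting p := P(A_0), the four partially identified probabilities satisfy P(C_{002}) = P(0|1) − p, P(C_{010}) = P(0|2) − p, P(C_{012}) = P(0|0) − P(0|1) − P(0|2) + p, and max{0, P(0|1) + P(0|2) − P(0|0)} ≤ p ≤ min{1, P(0|1), P(0|2)}. -/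
open MeasureTheory ProbabilityTheory

noncomputable section

variable {Ω : Type*} [MeasurableSpace Ω]

/-- Probability of an event, as a real number. -/
def prr (P : Measure Ω) (A : Set Ω) : ℝ := (P A).toReal

/-- Conditional expectation `E[X | C]` of `X` given the event `C`. -/
def cexp (P : Measure Ω) (X : Ω → ℝ) (C : Set Ω) : ℝ :=
  (∫ ω in C, X ω ∂P) / prr P C

/-- Conditional probability `P(D = d | Z = z)` (generalized propensity score). -/
def pscore {𝒟 𝒵 : Type*} (P : Measure Ω) (D : Ω → 𝒟) (Z : Ω → 𝒵) (d : 𝒟) (z : 𝒵) : ℝ :=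
  prr P ({ω | D ω = d} ∩ {ω | Z ω = z}) / prr P {ω | Z ω = z}

/-- Conditional average outcome `Ē_z(d) = E[Y·1(D = d) | Z = z]`. -/
def ebar {𝒟 𝒵 : Type*} (P : Measure Ω) (D : Ω → 𝒟) (Z : Ω → 𝒵) (Yobs : Ω → ℝ)
    (z : 𝒵) (d : 𝒟) : ℝ :=
  (∫ ω in {ω | D ω = d} ∩ {ω | Z ω = z}, Yobs ω ∂P) / prr P {ω | Z ω = z}

/-- Conditional mean outcome `E[Y | Z = z]`. -/
def ecz {𝒵 : Type*} (P : Measure Ω) (Z : Ω → 𝒵) (Yobs : Ω → ℝ) (z : 𝒵) : ℝ :=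
  (∫ ω in {ω | Z ω = z}, Yobs ω ∂P) / prr P {ω | Z ω = z}

/-- Response group `C_{abc} = {T(0) = a, T(1) = b, T(2) = c}` of the 3×3 model. -/
def grp3 {Ω : Type*} (T : Fin 3 → Ω → Fin 3) (a b c : Fin 3) : Set Ω :=
  {ω | T 0 ω = a ∧ T 1 ω = b ∧ T 2 ω = c}

/-- Revealed preference under strict one-to-one targeting leaves eight response vectors. -/
lemma response_of_targeting (U : Fin 3 → Fin 3 → ℝ) (v : Fin 3 → ℝ) (s : Fin 3 → Fin 3)
    (hmax : ∀ z t, t ≠ s z → U z t + v t < U z (s z) + v (s z))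
    (hΔ11 : U 0 1 - U 0 0 < U 1 1 - U 1 0)
    (hΔ21 : U 0 1 - U 0 0 = U 2 1 - U 2 0)
    (hΔ22 : U 0 2 - U 0 0 < U 2 2 - U 2 0)
    (hΔ12 : U 0 2 - U 0 0 = U 1 2 - U 1 0) :
    (s 0 = 0 → s 1 ≠ 2 ∧ s 2 ≠ 1) ∧ (s 0 = 1 → s 1 = 1 ∧ s 2 ≠ 0)
      ∧ (s 0 = 2 → s 2 = 2 ∧ s 1 ≠ 0) := by
  have key : ∀ z z' t t', s z = t → s z' = t' → t ≠ t' →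
      U z t' + v t' + (U z' t + v t) < U z t + v t + (U z' t' + v t') := by
    rintro z z' _ _ rfl rfl h
    exact add_lt_add (hmax z _ h.symm) (hmax z' _ h)
  refine ⟨fun h => ⟨fun h1 => ?_, fun h2 => ?_⟩, fun h => ⟨?_, fun h2 => ?_⟩,
    fun h => ⟨?_, fun h1 => ?_⟩⟩
  · linarith [key 0 1 0 2 h h1 (by decide)]
  · linarith [key 0 2 0 1 h h2 (by decide)]
  · by_contra hne
    have : s 1 = 0 ∨ s 1 = 2 := by grind
    rcases this with h1 | h1
    · linarith [key 0 1 1 0 h h1 (by decide)]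
    · linarith [key 0 1 1 2 h h1 (by decide)]
  · linarith [key 0 2 1 0 h h2 (by decide)]
  · by_contra hne
    have : s 2 = 0 ∨ s 2 = 1 := by grind
    rcases this with h2 | h2
    · linarith [key 0 2 2 0 h h2 (by decide)]
    · linarith [key 0 2 2 1 h h2 (by decide)]
  · linarith [key 0 1 2 0 h h1 (by decide)]

lemma prr_congr_ae {P : Measure Ω} {A B : Set Ω} (h : ∀ᵐ ω ∂P, ω ∈ A ↔ ω ∈ B) :
    prr P A = prr P B :=
  congrArg ENNReal.toReal (measure_congr (Filter.eventuallyEq_set.2 h))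

lemma prr_union {P : Measure Ω} [IsFiniteMeasure P] {A B : Set Ω} (hd : Disjoint A B)
    (hB : MeasurableSet B) : prr P (A ∪ B) = prr P A + prr P B :=
  measureReal_union hd hB

lemma measurableSet_grp3 {T : Fin 3 → Ω → Fin 3} (hT : ∀ z, Measurable (T z)) (a b c : Fin 3) :
    MeasurableSet (grp3 T a b c) :=
  (hT 0 (measurableSet_singleton a)).inter
    ((hT 1 (measurableSet_singleton b)).inter (hT 2 (measurableSet_singleton c)))

/-- Under an independent instrument, propensity scores are the marginal laws of the
counterfactual treatments. -/
lemma pscore_eq_prr {𝒯 𝒵 : Type*} [MeasurableSpace 𝒯] [MeasurableSingletonClass 𝒯]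
    [MeasurableSpace 𝒵] [MeasurableSingletonClass 𝒵]
    {P : Measure Ω} [IsFiniteMeasure P] {T : 𝒵 → Ω → 𝒯} {Z : Ω → 𝒵} {z : 𝒵}
    (hZpos : 0 < P {ω | Z ω = z}) (hindep : IndepFun Z (T z) P) (t : 𝒯) :
    pscore P (fun ω => T (Z ω) ω) Z t z = prr P {ω | T z ω = t} := by
  have hset : {ω | T (Z ω) ω = t} ∩ {ω | Z ω = z} = Z ⁻¹' {z} ∩ T z ⁻¹' {t} := by
    ext ω
    simp only [Set.mem_inter_iff, Set.mem_ofPred_eq, Set.mem_preimage, Set.mem_singleton_iff]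
    constructor
    · rintro ⟨h, rfl⟩
      exact ⟨rfl, h⟩
    · rintro ⟨rfl, h⟩
      exact ⟨h, rfl⟩
  have hmul := hindep.measure_inter_preimage_eq_mul {z} {t} (measurableSet_singleton z)
    (measurableSet_singleton t)
  have hne : (P {ω | Z ω = z}).toReal ≠ 0 :=
    (ENNReal.toReal_pos hZpos.ne' (measure_ne_top P _)).ne'
  unfold pscore prr
  rw [hset, hmul, ENNReal.toReal_mul]
  exact mul_div_cancel_left₀ _ hne

/-- Proposition (response-group probabilities in the 3×3 model under strict, one-to-one
targeting), together with the testable implications and the parameterization of the four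
partially identified group probabilities by `p = P(A₀)`. -/
theorem statement8
    (P : Measure Ω) [IsProbabilityMeasure P]
    (T : Fin 3 → Ω → Fin 3) (Z : Ω → Fin 3)
    (U : Fin 3 → Fin 3 → ℝ) (u : Fin 3 → Ω → ℝ)
    (hTmeas : ∀ z, Measurable (T z)) (hZmeas : Measurable Z)
    (humeas : ∀ t, Measurable (u t))
    (hZpos : ∀ z, 0 < P {ω | Z ω = z})
    (hindep : IndepFun Z (fun ω => ((fun z => T z ω), (fun t => u t ω))) P)
    (hmax : ∀ᵐ ω ∂P, ∀ z t, t ≠ T z ω →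
      U z t + u t ω < U z (T z ω) + u (T z ω) ω)
    (hΔ11 : U 0 1 - U 0 0 < U 1 1 - U 1 0)
    (hΔ21 : U 0 1 - U 0 0 = U 2 1 - U 2 0)
    (hΔ22 : U 0 2 - U 0 0 < U 2 2 - U 2 0)
    (hΔ12 : U 0 2 - U 0 0 = U 1 2 - U 1 0) :
    prr P (grp3 T 1 1 1) = pscore P (fun ω => T (Z ω) ω) Z 1 2
    ∧ prr P (grp3 T 2 2 2) = pscore P (fun ω => T (Z ω) ω) Z 2 1
    ∧ prr P (grp3 T 1 1 2)
        = pscore P (fun ω => T (Z ω) ω) Z 1 0 - pscore P (fun ω => T (Z ω) ω) Z 1 2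
    ∧ prr P (grp3 T 2 1 2)
        = pscore P (fun ω => T (Z ω) ω) Z 2 0 - pscore P (fun ω => T (Z ω) ω) Z 2 1
    ∧ prr P (grp3 T 0 1 0 ∪ grp3 T 0 1 2)
        = pscore P (fun ω => T (Z ω) ω) Z 0 0 - pscore P (fun ω => T (Z ω) ω) Z 0 1
    ∧ prr P (grp3 T 0 0 2 ∪ grp3 T 0 1 2)
        = pscore P (fun ω => T (Z ω) ω) Z 0 0 - pscore P (fun ω => T (Z ω) ω) Z 0 2
    ∧ prr P (grp3 T 0 1 0 ∪ grp3 T 0 0 0) = pscore P (fun ω => T (Z ω) ω) Z 0 2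
    -- testable implications
    ∧ pscore P (fun ω => T (Z ω) ω) Z 1 2 ≤ pscore P (fun ω => T (Z ω) ω) Z 1 0
    ∧ pscore P (fun ω => T (Z ω) ω) Z 2 1 ≤ pscore P (fun ω => T (Z ω) ω) Z 2 0
    ∧ max (pscore P (fun ω => T (Z ω) ω) Z 0 1) (pscore P (fun ω => T (Z ω) ω) Z 0 2)
        ≤ pscore P (fun ω => T (Z ω) ω) Z 0 0
    -- parameterization by p = P(A₀)
    ∧ prr P (grp3 T 0 0 2)
        = pscore P (fun ω => T (Z ω) ω) Z 0 1 - prr P (grp3 T 0 0 0)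
    ∧ prr P (grp3 T 0 1 0)
        = pscore P (fun ω => T (Z ω) ω) Z 0 2 - prr P (grp3 T 0 0 0)
    ∧ prr P (grp3 T 0 1 2)
        = pscore P (fun ω => T (Z ω) ω) Z 0 0 - pscore P (fun ω => T (Z ω) ω) Z 0 1
          - pscore P (fun ω => T (Z ω) ω) Z 0 2 + prr P (grp3 T 0 0 0)
    ∧ max 0 (pscore P (fun ω => T (Z ω) ω) Z 0 1 + pscore P (fun ω => T (Z ω) ω) Z 0 2
          - pscore P (fun ω => T (Z ω) ω) Z 0 0)
        ≤ prr P (grp3 T 0 0 0)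
    ∧ prr P (grp3 T 0 0 0)
        ≤ min 1 (min (pscore P (fun ω => T (Z ω) ω) Z 0 1)
            (pscore P (fun ω => T (Z ω) ω) Z 0 2)) := by
  have hps : ∀ t z, pscore P (fun ω => T (Z ω) ω) Z t z = prr P {ω | T z ω = t} := fun t z =>
    pscore_eq_prr (hZpos z)
      (hindep.comp measurable_id ((measurable_pi_apply z).comp measurable_fst)) t
  have hm := measurableSet_grp3 hTmeas
  have hdisj : ∀ a b c a' b' c', (a, b, c) ≠ (a', b', c') →
      Disjoint (grp3 T a b c) (grp3 T a' b' c') := by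
    intro a b c a' b' c' hne
    rw [Set.disjoint_left]
    rintro ω ⟨rfl, rfl, rfl⟩ ⟨rfl, rfl, rfl⟩
    exact hne rfl
  have hresp : ∀ᵐ ω ∂P, (T 0 ω = 0 → T 1 ω ≠ 2 ∧ T 2 ω ≠ 1)
      ∧ (T 0 ω = 1 → T 1 ω = 1 ∧ T 2 ω ≠ 0) ∧ (T 0 ω = 2 → T 2 ω = 2 ∧ T 1 ω ≠ 0) := by
    filter_upwards [hmax] with ω hω
    exact response_of_targeting U (fun t => u t ω) (fun z => T z ω) hω hΔ11 hΔ21 hΔ22 hΔ12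
  have h12 : prr P {ω | T 2 ω = 1} = prr P (grp3 T 1 1 1) := by
    apply prr_congr_ae
    filter_upwards [hresp] with ω hω
    simp only [grp3, Set.mem_ofPred_eq]
    grind
  have h21 : prr P {ω | T 1 ω = 2} = prr P (grp3 T 2 2 2) := by
    apply prr_congr_ae
    filter_upwards [hresp] with ω hω
    simp only [grp3, Set.mem_ofPred_eq]
    grind
  have h10 : prr P {ω | T 0 ω = 1} = prr P (grp3 T 1 1 1) + prr P (grp3 T 1 1 2) := by
    rw [← prr_union (hdisj _ _ _ _ _ _ (by decide)) (hm _ _ _)]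
    apply prr_congr_ae
    filter_upwards [hresp] with ω hω
    simp only [grp3, Set.mem_union, Set.mem_ofPred_eq]
    grind
  have h20 : prr P {ω | T 0 ω = 2} = prr P (grp3 T 2 2 2) + prr P (grp3 T 2 1 2) := by
    rw [← prr_union (hdisj _ _ _ _ _ _ (by decide)) (hm _ _ _)]
    apply prr_congr_ae
    filter_upwards [hresp] with ω hω
    simp only [grp3, Set.mem_union, Set.mem_ofPred_eq]
    grind
  have h01 : prr P {ω | T 1 ω = 0} = prr P (grp3 T 0 0 2) + prr P (grp3 T 0 0 0) := by
    rw [← prr_union (hdisj _ _ _ _ _ _ (by decide)) (hm _ _ _)]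
    apply prr_congr_ae
    filter_upwards [hresp] with ω hω
    simp only [grp3, Set.mem_union, Set.mem_ofPred_eq]
    grind
  have h02 : prr P {ω | T 2 ω = 0} = prr P (grp3 T 0 1 0) + prr P (grp3 T 0 0 0) := by
    rw [← prr_union (hdisj _ _ _ _ _ _ (by decide)) (hm _ _ _)]
    apply prr_congr_ae
    filter_upwards [hresp] with ω hω
    simp only [grp3, Set.mem_union, Set.mem_ofPred_eq]
    grind
  have hU1 : prr P (grp3 T 0 1 0 ∪ grp3 T 0 1 2)
      = prr P (grp3 T 0 1 0) + prr P (grp3 T 0 1 2) :=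
    prr_union (hdisj _ _ _ _ _ _ (by decide)) (hm _ _ _)
  have hU2 : prr P (grp3 T 0 0 2 ∪ grp3 T 0 1 2)
      = prr P (grp3 T 0 0 2) + prr P (grp3 T 0 1 2) :=
    prr_union (hdisj _ _ _ _ _ _ (by decide)) (hm _ _ _)
  have hU3 : prr P (grp3 T 0 1 0 ∪ grp3 T 0 0 0)
      = prr P (grp3 T 0 1 0) + prr P (grp3 T 0 0 0) :=
    prr_union (hdisj _ _ _ _ _ _ (by decide)) (hm _ _ _)
  have h00 : prr P {ω | T 0 ω = 0} = prr P (grp3 T 0 0 2) + prr P (grp3 T 0 0 0)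
      + (prr P (grp3 T 0 1 0) + prr P (grp3 T 0 1 2)) := by
    rw [← hU1, ← prr_union (hdisj _ _ _ _ _ _ (by decide)) (hm _ _ _), ← prr_union ?_
      ((hm _ _ _).union (hm _ _ _))]
    · apply prr_congr_ae
      filter_upwards [hresp] with ω hω
      simp only [grp3, Set.mem_union, Set.mem_ofPred_eq]
      grind
    · simp only [Set.disjoint_union_left, Set.disjoint_union_right]
      refine ⟨⟨?_, ?_⟩, ?_, ?_⟩ <;> exact hdisj _ _ _ _ _ _ (by decide)
  have hnn : ∀ a b c, 0 ≤ prr P (grp3 T a b c) := fun _ _ _ => ENNReal.toReal_nonneg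
  have hle : prr P (grp3 T 0 0 0) ≤ 1 := measureReal_le_one
  simp only [hps, hU1, hU2, hU3, h12, h21, h10, h20, h01, h02, h00]
  refine ⟨trivial, trivial, ?_, ?_, ?_, ?_, trivial, ?_, ?_, max_le ?_ ?_, ?_, ?_, ?_, max_le ?_ ?_,
    le_min ?_ (le_min ?_ ?_)⟩ <;>
  linarith [hnn 1 1 2, hnn 2 1 2, hnn 0 0 0, hnn 0 0 2, hnn 0 1 0, hnn 0 1 2]
end
end
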